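/- Let F be a field of characteristic ≠ 2. Suppose A, B ∈ M₂(F) are invertible, A − 1 is invertible, AB ≠ BA, and A, B satisfy the fundamental equation. Then either (tr(A) = det(A) and tr(AB⁻¹) = 0), or there exists an invertible matrix P ∈ M₂(F) such that P⁻¹AP and P⁻¹BP are both upper triangular and, writing P⁻¹AP = [[α, x],[0, δ]] and P⁻¹BP = [[β, y],[0, γ]], the diagonal entries satisfy β = γ(1 − α). -/

import Mathlib

open Matrix

/-- A nonzero singular traceless `2 × 2` matrix is similar to the nilpotent Jordan block. -/
lemma exists_isUnit_mul_eq_mul_nilpotent_block {F : Type*} [Field F]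
    (N : Matrix (Fin 2) (Fin 2) F) (hN : N ≠ 0) (htr : N.trace = 0) (hdet : N.det = 0) :
    ∃ P : Matrix (Fin 2) (Fin 2) F, IsUnit P ∧ N * P = P * !![0, 1; 0, 0] := by
  rw [Matrix.trace_fin_two] at htr
  rw [Matrix.det_fin_two] at hdet
  have h11 : N 1 1 = -N 0 0 := by linear_combination htr
  by_cases hc : N 1 0 = 0
  · have ha : N 0 0 = 0 := by
      have : N 0 0 ^ 2 = 0 := by rw [hc, h11] at hdet; linear_combination -hdet
      exact pow_eq_zero_iff two_ne_zero |>.mp this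
    have hb : N 0 1 ≠ 0 := by
      intro hb
      apply hN
      ext i j
      fin_cases i <;> fin_cases j <;> simp [ha, hb, hc, h11]
    refine ⟨!![N 0 1, 0; 0, 1], ?_, ?_⟩
    · simp [Matrix.isUnit_iff_isUnit_det, Matrix.det_fin_two, hb]
    · ext i j
      fin_cases i <;> fin_cases j <;> simp [Matrix.mul_apply, Fin.sum_univ_two, ha, hc, h11]
  · refine ⟨!![N 0 0, 1; N 1 0, 0], ?_, ?_⟩
    · simp [Matrix.isUnit_iff_isUnit_det, Matrix.det_fin_two, hc]
    · ext i j
      fin_cases i <;> fin_cases j <;> simp [Matrix.mul_apply, Fin.sum_univ_two]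
      · linear_combination -hdet + N 0 0 * h11
      · linear_combination N 1 0 * h11

/-- If the commutator of `A` and `B` is the nilpotent Jordan block, then `A` and `B` are upper
triangular, and the fundamental equation determines the ratio of the eigenvalues of `B`. -/
lemma upper_triangular_of_commutator_eq_nilpotent_block {F : Type*} [Field F]
    (A B A' B' : Matrix (Fin 2) (Fin 2) F) (hA : A * A' = 1) (hB : B * B' = 1)
    (hN : A * B - B * A = !![0, 1; 0, 0])
    (h : (1 - A) * B' * !![0, 1; 0, 0] = !![0, 1; 0, 0] * A' * B' * A) :
    A 1 0 = 0 ∧ B 1 0 = 0 ∧ B 0 0 = B 1 1 * (1 - A 0 0) := by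
  have n (i j : Fin 2) := congrFun (congrFun hN i) j
  have n00 := n 0 0
  have n01 := n 0 1
  have n10 := n 1 0
  have n11 := n 1 1
  have a10 := congrFun (congrFun hA 1) 0
  have a11 := congrFun (congrFun hA 1) 1
  have b00 := congrFun (congrFun hB 0) 0
  have b10 := congrFun (congrFun hB 1) 0
  have b11 := congrFun (congrFun hB 1) 1
  have k := congrFun (congrFun h 0) 1
  simp [Matrix.mul_apply, Fin.sum_univ_two, -Matrix.cons_mul] at n00 n01 n10 n11 a10 a11 b00 b10 b11 k
  have hA10 : A 1 0 = 0 := by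
    linear_combination -A 0 0 * n00 - A 1 0 * n01 - A 0 1 * n10 - A 1 1 * n11
  have hB10 : B 1 0 = 0 := by
    linear_combination -B 0 0 * n00 - B 1 0 * n01 - B 0 1 * n10 - B 1 1 * n11
  refine ⟨hA10, hB10, ?_⟩
  simp only [hA10, hB10, zero_mul, zero_add] at a10 a11 b00 b10 b11 k
  have hA' : A' 1 0 = 0 := (mul_eq_zero.mp a10).resolve_left (left_ne_zero_of_mul_eq_one a11)
  have hB' : B' 1 0 = 0 := (mul_eq_zero.mp b10).resolve_left (left_ne_zero_of_mul_eq_one b11)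
  simp only [hA', hB', zero_mul, zero_add, mul_zero, add_zero] at b00 k
  linear_combination (-B 0 0) * b11 + B 1 1 * (1 - A 0 0) * b00 - B 0 0 * B 1 1 * k
    - B 0 0 * B 1 1 * B' 1 1 * a11

/-- For non-commuting invertible 2×2 matrix solutions `A, B` of the
fundamental equation (with `A - 1` invertible), either `tr A = det A` and
`tr (A B⁻¹) = 0`, or `A, B` are simultaneously conjugate to upper triangular
matrices whose diagonals satisfy `β = γ (1 - α)`. -/
theorem stmt0 {F : Type*} [Field F] (h2 : (2 : F) ≠ 0)
    (A B : Matrix (Fin 2) (Fin 2) F)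
    (hA : IsUnit A) (hB : IsUnit B) (hA1 : IsUnit (A - 1))
    (hnc : A * B ≠ B * A)
    (hfund : A⁻¹ * B⁻¹ * A * B - B⁻¹ * A * B = B * A⁻¹ * B⁻¹ * A - A) :
    (A.trace = A.det ∧ (A * B⁻¹).trace = 0) ∨
      ∃ P : Matrix (Fin 2) (Fin 2) F, IsUnit P ∧
        (P⁻¹ * A * P) 1 0 = 0 ∧ (P⁻¹ * B * P) 1 0 = 0 ∧
        (P⁻¹ * B * P) 0 0 = (P⁻¹ * B * P) 1 1 * (1 - (P⁻¹ * A * P) 0 0) := by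
  have hAd := (Matrix.isUnit_iff_isUnit_det A).mp hA
  have hBd := (Matrix.isUnit_iff_isUnit_det B).mp hB
  have hAA := Matrix.mul_nonsing_inv A hAd
  have hBB := Matrix.mul_nonsing_inv B hBd
  have hBB' := Matrix.nonsing_inv_mul B hBd
  obtain ⟨N, hN⟩ : ∃ N, N = A * B - B * A := ⟨_, rfl⟩
  have key : (1 - A) * B⁻¹ * N = N * A⁻¹ * B⁻¹ * A := by
    have h := congrArg (A * ·) hfund
    simp only [mul_sub, ← mul_assoc, hAA, one_mul] at h
    have e1 : (1 - A) * B⁻¹ * N = B⁻¹ * A * B - A * B⁻¹ * A * B - A + A * A := by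
      have : B⁻¹ * N = B⁻¹ * A * B - A := by
        rw [hN, mul_sub, ← mul_assoc, ← mul_assoc, hBB', one_mul]
      rw [mul_assoc, this]
      noncomm_ring
    have e2 : N * A⁻¹ * B⁻¹ * A = A * B * A⁻¹ * B⁻¹ * A - A := by
      rw [hN, sub_mul, sub_mul, sub_mul, mul_assoc B A, hAA, mul_one, hBB, one_mul]
    rw [e1, e2, h]
    abel
  by_cases hd : N.det = 0
  · right
    have htr : N.trace = 0 := by rw [hN, Matrix.trace_sub, Matrix.trace_mul_comm, sub_self]
    obtain ⟨P, hP, hNP⟩ := exists_isUnit_mul_eq_mul_nilpotent_block N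
      (by rw [hN]; exact sub_ne_zero.mpr hnc) htr hd
    have hPd := (Matrix.isUnit_iff_isUnit_det P).mp hP
    have hPP := Matrix.mul_nonsing_inv P hPd
    have hPP' := Matrix.nonsing_inv_mul P hPd
    have conj_mul (X Y : Matrix (Fin 2) (Fin 2) F) :
        P⁻¹ * X * P * (P⁻¹ * Y * P) = P⁻¹ * (X * Y) * P := by
      rw [← mul_assoc, ← mul_assoc, mul_assoc (P⁻¹ * X) P, hPP, mul_one, mul_assoc P⁻¹ X]
    have hE : !![0, 1; 0, 0] = P⁻¹ * N * P := by
      rw [mul_assoc, hNP, ← mul_assoc, hPP', one_mul]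
    refine ⟨P, hP, upper_triangular_of_commutator_eq_nilpotent_block _ _
      (P⁻¹ * A⁻¹ * P) (P⁻¹ * B⁻¹ * P) ?_ ?_ ?_ ?_⟩
    · rw [conj_mul, hAA, mul_one, hPP']
    · rw [conj_mul, hBB, mul_one, hPP']
    · rw [hE, conj_mul, conj_mul, hN, mul_sub, sub_mul]
    · have h1 : 1 - P⁻¹ * A * P = P⁻¹ * (1 - A) * P := by
        rw [mul_sub, sub_mul, mul_one, hPP']
      rw [hE, h1, conj_mul, conj_mul, conj_mul, conj_mul, conj_mul, key]
  · left
    have hNu : IsUnit N.det := isUnit_iff_ne_zero.mpr hd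
    have hconj : (1 - A) * B⁻¹ = N * (A⁻¹ * B⁻¹ * A) * N⁻¹ := by
      rw [← mul_assoc, ← mul_assoc, ← key, mul_assoc, Matrix.mul_nonsing_inv N hNu, mul_one]
    constructor
    · have h := congrArg Matrix.det key
      simp only [Matrix.det_mul, Matrix.det_nonsing_inv] at h
      have hBi : Ring.inverse B.det ≠ 0 := by
        rw [Ring.inverse_eq_inv']; exact inv_ne_zero hBd.ne_zero
      have hAi : Ring.inverse A.det * A.det = 1 := Ring.inverse_mul_cancel _ hAd
      have h1 : (1 - A).det = 1 := by
        apply mul_right_cancel₀ (mul_ne_zero hBi hd)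
        linear_combination h + N.det * Ring.inverse B.det * hAi
      rw [Matrix.det_fin_two] at h1
      simp at h1
      rw [Matrix.det_fin_two, Matrix.trace_fin_two]
      linear_combination -h1
    · have h := congrArg Matrix.trace hconj
      rw [Matrix.trace_mul_comm (N * _), ← mul_assoc, Matrix.nonsing_inv_mul N hNu, one_mul,
        Matrix.trace_mul_comm (A⁻¹ * B⁻¹), ← mul_assoc, hAA, one_mul, sub_mul, one_mul,
        Matrix.trace_sub] at h
      linear_combination -h
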